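/- Fix α > 1 and 0 < δ < min{H_2, H_3}, let ã_1 = α_0 − h (Σ (1+α^{μ+r_i}) m_i β_i) δ^μ and b_3 = (w_1 + h w_2 + 2h Σ β_i m_i) h, and let Δ_α > 0 be a root of the equation α_1 Δ_α^γ + b_3 Δ_α^{γ+μ} = ã_1 δ^γ. Then for every initial function φ with ‖φ‖_H < Δ_α, every solution x(·,φ) of ẋ(t) = f(x(t), x(t−h)) defined for all t ≥ 0 satisfies ‖x(t,φ)‖_{r,p} → 0 as t → ∞; i.e. the ball {φ : ‖φ‖_H < Δ_α} is contained in the attraction region of the trivial solution. -/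

import Mathlib

set_option linter.unusedVariables false

noncomputable def hnorm (n : ℕ) (r : Fin n → ℝ) (p : ℝ) (x : Fin n → ℝ) : ℝ :=
  (∑ i, |x i| ^ (p / r i)) ^ (1 / p)

noncomputable def pd (n : ℕ) (f : (Fin n → ℝ) → (Fin n → ℝ) → (Fin n → ℝ))
    (i j : Fin n) (x y : Fin n → ℝ) : ℝ :=
  deriv (fun t => f (Function.update x j t) y i) (x j)

noncomputable def vfun (n : ℕ) (r : Fin n → ℝ) (p h μ γ w1 w2 : ℝ)
    (f : (Fin n → ℝ) → (Fin n → ℝ) → (Fin n → ℝ)) (V : (Fin n → ℝ) → ℝ)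
    (φ : ℝ → Fin n → ℝ) : ℝ :=
  V (φ 0) + fderiv ℝ V (φ 0) (∫ θ in (-h)..(0:ℝ), f (φ 0) (φ θ))
    + ∫ θ in (-h)..(0:ℝ), (w1 + (h + θ) * w2) * hnorm n r p (φ θ) ^ (γ + μ)

noncomputable def segNorm (n : ℕ) (r : Fin n → ℝ) (p h : ℝ)
    (x : ℝ → Fin n → ℝ) (t : ℝ) : ℝ :=
  sSup ((fun θ => hnorm n r p (x (t + θ))) '' Set.Icc (-h) 0)

def IsSol (n : ℕ) (h : ℝ) (f : (Fin n → ℝ) → (Fin n → ℝ) → (Fin n → ℝ))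
    (x : ℝ → Fin n → ℝ) : Prop :=
  ContinuousOn x (Set.Ici (-h)) ∧
  ∀ t : ℝ, 0 ≤ t → HasDerivWithinAt x (f (x t) (x (t - h))) (Set.Ici 0) t


open Set Filter Topology MeasureTheory

section DelayEnergy

theorem sub_le_mul_sub_of_hasDerivAt_le {F F' : ℝ → ℝ} {a b c : ℝ}
    (hF : ∀ t, HasDerivAt F (F' t) t) (hab : a ≤ b) (hle : ∀ t ∈ Icc a b, F' t ≤ c) :
    F b - F a ≤ c * (b - a) := by
  have := image_le_of_deriv_right_le_deriv_boundary (f := F) (B := fun t => F a + c * (t - a))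
    (B' := fun _ => c) (fun t _ => (hF t).continuousAt.continuousWithinAt)
    (fun t _ => (hF t).hasDerivWithinAt) (by simp) (by fun_prop)
    (fun t _ => by
      simpa using ((((hasDerivAt_id t).sub_const a).const_mul c).const_add (F a)).hasDerivWithinAt)
    (fun t ht => hle t (Ico_subset_Icc_self ht)) ⟨hab, le_rfl⟩
  linarith

variable {E : Type*} [NormedAddCommGroup E] [NormedSpace ℝ E] {h : ℝ} {f : E → E → E}
  {V N : E → ℝ} {X : ℝ → E}

/-- Along a solution, the derivative of `V` is compared with its value on the diagonal at the
delayed time; `P` is a primitive of `N` along the solution. -/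
theorem fderiv_apply_le_delayed_diagonal {κ t : ℝ} {P : ℝ → ℝ} {S : Set E} (hh : 0 ≤ h)
    (hd : ∀ y, Differentiable ℝ fun z => f z y) (hV : ContDiff ℝ 2 V)
    (hpt : ∀ z ∈ S, ∀ y ∈ S, ∀ y' ∈ S,
      |fderiv ℝ (fderiv ℝ V) z (f z y') (f z y)
        + fderiv ℝ V z (fderiv ℝ (fun z => f z y) z (f z y'))|
        ≤ κ * (4 * N z + 2 * N y + 2 * N y'))
    (hX : Continuous X)
    (hu : ∀ t, 0 ≤ t → HasDerivWithinAt X (f (X t) (X (t - h))) (Ici t) t)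
    (hP : ∀ t, HasDerivAt P (N (X t)) t)
    (ht : h ≤ t) (hS : ∀ s ∈ Icc (t - 2 * h) t, X s ∈ S) :
    fderiv ℝ V (X t) (f (X t) (X (t - h))) ≤
      fderiv ℝ V (X (t - h)) (f (X (t - h)) (X (t - h))) +
        κ * (4 * (P t - P (t - h)) + 2 * h * N (X (t - h)) + 2 * (P (t - h) - P (t - 2 * h))) := by
  set a := t - h with ha
  have hV1 : ContDiff ℝ 1 (fderiv ℝ V) := hV.fderiv_right (by norm_num)
  have hB : ∀ s, HasDerivAt (fun s => fderiv ℝ V (X a) (f (X a) (X a)) +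
      κ * (4 * (P s - P a) + 2 * (s - a) * N (X a) + 2 * (P (s - h) - P (a - h))))
      (κ * (4 * N (X s) + 2 * N (X a) + 2 * N (X (s - h)))) s := fun s => by
    have h1 := ((hP s).sub_const (P a)).const_mul 4
    have h2 := (((hasDerivAt_id s).sub_const a).const_mul 2).mul_const (N (X a))
    have h3 := (((hP (s - h)).comp_sub_const s h).sub_const (P (a - h))).const_mul 2
    refine ((((h1.add h2).add h3).const_mul κ).const_add _).congr_deriv ?_
    ring
  have key := image_le_of_deriv_right_le_deriv_boundary (a := a) (b := t)
    (f := fun s => fderiv ℝ V (X s) (f (X s) (X a)))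
    (((hV.continuous_fderiv (by norm_num)).comp hX).clm_apply
      ((hd (X a)).continuous.comp hX)).continuousOn
    (fun s hs => by
      have hs0 := hu s (by linarith [hs.1])
      have g1 := ((hV1.differentiable (by norm_num)) (X s)).hasFDerivAt.comp_hasDerivWithinAt s hs0
      exact g1.clm_apply ((hd (X a) (X s)).hasFDerivAt.comp_hasDerivWithinAt s hs0))
    (by simp) (fun s _ => (hB s).continuousAt.continuousWithinAt)
    (fun s _ => (hB s).hasDerivWithinAt)
    (fun s hs => (le_abs_self _).trans (hpt _ (hS s ⟨by linarith [hs.1], hs.2.le⟩) _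
      (hS a ⟨by linarith, by linarith⟩) _ (hS (s - h) ⟨by linarith [hs.1], by linarith [hs.2]⟩)))
    (show t ∈ Icc a t from ⟨by linarith, le_rfl⟩)
  refine key.trans_eq ?_
  rw [show a - h = t - 2 * h by rw [ha]; ring, show t - a = h by rw [ha]; ring]

theorem lyapunov_le_of_derivative_bound {σ K T : ℝ} {P : ℝ → ℝ} (hV : ContDiff ℝ 2 V)
    (hX : Continuous X)
    (hu : ∀ t, 0 ≤ t → HasDerivWithinAt X (f (X t) (X (t - h))) (Ici t) t)
    (hP : ∀ t, HasDerivAt P (N (X t)) t) (hP0 : P 0 = 0)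
    (hσ : ∀ t ∈ Icc 0 T, fderiv ℝ V (X t) (f (X t) (X (t - h))) ≤ σ * (N (X t) + K))
    (hT : 0 ≤ T) : V (X T) ≤ V (X 0) + σ * (P T + T * K) := by
  have hB : ∀ t, HasDerivAt (fun t => V (X 0) + σ * (P t + t * K)) (σ * (N (X t) + K)) t :=
    fun t => by
      refine ((((hP t).add ((hasDerivAt_id t).mul_const K)).const_mul σ).const_add _).congr_deriv ?_
      ring
  exact image_le_of_deriv_right_le_deriv_boundary (f := fun t => V (X t))
    (hV.continuous.comp hX).continuousOn
    (fun t ht => ((hV.differentiable (by norm_num)) (X t)).hasFDerivAt.comp_hasDerivWithinAt t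
      (hu t ht.1)) (by simp [hP0]) (fun t _ => (hB t).continuousAt.continuousWithinAt)
    (fun t _ => (hB t).hasDerivWithinAt) (fun t ht => hσ t (Ico_subset_Icc_self ht)) ⟨hT, le_rfl⟩

/-- Energy estimate along a solution that stays in `S`. -/
theorem lyapunov_add_integral_le {w κ σ K M T : ℝ} {P : ℝ → ℝ} {S : Set E} (hh : 0 < h)
    (hκ : 0 ≤ κ) (hσκ : 4 * h * κ ≤ σ)
    (hd : ∀ y, Differentiable ℝ fun z => f z y) (hV : ContDiff ℝ 2 V) (hN0 : ∀ z, 0 ≤ N z)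
    (hVf : ∀ z, fderiv ℝ V z (f z z) ≤ -w * N z)
    (hpt : ∀ z ∈ S, ∀ y ∈ S, ∀ y' ∈ S,
      |fderiv ℝ (fderiv ℝ V) z (f z y') (f z y)
        + fderiv ℝ V z (fderiv ℝ (fun z => f z y) z (f z y'))|
        ≤ κ * (4 * N z + 2 * N y + 2 * N y'))
    (hX : Continuous X)
    (hu : ∀ t, 0 ≤ t → HasDerivWithinAt X (f (X t) (X (t - h))) (Ici t) t)
    (hP : ∀ t, HasDerivAt P (N (X t)) t) (hP0 : P 0 = 0) (hT : h ≤ T)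
    (hσ : ∀ t ∈ Icc 0 T, fderiv ℝ V (X t) (f (X t) (X (t - h))) ≤ σ * (N (X t) + K))
    (hS : ∀ t ∈ Icc (-h) T, X t ∈ S) (hK : ∀ t ∈ Icc 0 T, N (X t) ≤ K)
    (hM : ∀ t ∈ Icc (-h) 0, N (X t) ≤ M) :
    V (X T) + (w - 8 * h * κ) * P (T - h) ≤ V (X 0) + 2 * σ * h * K + 2 * κ * h ^ 2 * M := by
  have hPc : Continuous P := continuous_iff_continuousAt.2 fun t => (hP t).continuousAt
  obtain ⟨Q, hQ⟩ : ∃ Q : ℝ → ℝ, ∀ t, HasDerivAt Q (P t) t :=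
    ⟨fun t => ∫ s in (0 : ℝ)..t, P s, fun t => intervalIntegral.integral_hasDerivAt_right
      (hPc.intervalIntegrable _ _) (hPc.stronglyMeasurableAtFilter _ _) hPc.continuousAt⟩
  have hmono : Monotone P :=
    monotone_of_deriv_nonneg (fun t => (hP t).differentiableAt) fun t => by
      rw [(hP t).deriv]; exact hN0 _
  have hstart := lyapunov_le_of_derivative_bound (T := h) hV hX hu hP hP0
    (fun t ht => hσ t ⟨ht.1, ht.2.trans hT⟩) hh.le
  have hB : ∀ t, HasDerivAt (fun t => V (X h) - (w - 2 * h * κ) * (P (t - h) - P 0)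
      + κ * (4 * (Q t - Q h - (Q (t - h) - Q 0))
        + 2 * (Q (t - h) - Q 0 - (Q (t - 2 * h) - Q (-h)))))
      (-(w - 2 * h * κ) * N (X (t - h)) + κ * (4 * (P t - P (t - h))
        + 2 * (P (t - h) - P (t - 2 * h)))) t := fun t => by
    have h1 := (((hP (t - h)).comp_sub_const t h).sub_const (P 0)).const_mul (w - 2 * h * κ)
    have h2 := ((hQ (t - h)).comp_sub_const t h).sub_const (Q 0)
    have h3 := ((hQ (t - 2 * h)).comp_sub_const t (2 * h)).sub_const (Q (-h))
    have h4 := (((hQ t).sub_const (Q h)).sub h2).const_mul 4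
    refine ((h1.const_sub (V (X h))).add
      ((h4.add ((h2.sub h3).const_mul 2)).const_mul κ)).congr_deriv ?_
    ring
  have hmain := image_le_of_deriv_right_le_deriv_boundary (a := h) (b := T)
    (f := fun t => V (X t)) (hV.continuous.comp hX).continuousOn
    (fun t ht => ((hV.differentiable (by norm_num)) (X t)).hasFDerivAt.comp_hasDerivWithinAt t
      (hu t (hh.le.trans ht.1))) (by simp [show h - 2 * h = -h by ring])
    (fun t _ => (hB t).continuousAt.continuousWithinAt) (fun t _ => (hB t).hasDerivWithinAt)
    (fun t ht => by
      have h1 := fderiv_apply_le_delayed_diagonal hh.le hd hV hpt hX hu hP ht.1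
        fun s hs => hS s ⟨by linarith [hs.1, ht.1], hs.2.trans ht.2.le⟩
      have h2 := hVf (X (t - h))
      refine h1.trans ?_
      linarith)
    (show T ∈ Icc h T from ⟨hT, le_rfl⟩)
  have hPsub : ∀ a b, 0 ≤ a → a ≤ b → b ≤ T → P b - P a ≤ K * (b - a) := fun a b ha hab hb =>
    sub_le_mul_sub_of_hasDerivAt_le hP hab fun t ht => hK t ⟨ha.trans ht.1, ht.2.trans hb⟩
  have hshift : Q (T - h + h) - Q h - (Q (T - h + 0) - Q 0)
      ≤ (P (T - h) - P h + K * h) * (h - 0) := by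
    have := sub_le_mul_sub_of_hasDerivAt_le (F := fun s => Q (T - h + s) - Q s)
      (F' := fun s => P (T - h + s) - P s) (c := P (T - h) - P h + K * h)
      (fun s => ((hQ (T - h + s)).comp_const_add (T - h) s).sub (hQ s)) hh.le fun s hs => by
        have h1 := hPsub (T - h) (T - h + s) (by linarith) (by linarith [hs.1]) (by linarith [hs.2])
        have h2 := hPsub s h hs.1 hs.2 hT
        linarith
    linarith
  have hwindow : Q (T - h) - Q (T - h - h) ≤ P (T - h) * (T - h - (T - h - h)) :=
    sub_le_mul_sub_of_hasDerivAt_le hQ (by linarith) fun t ht => hmono ht.2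
  have hhist : Q (-h) - Q 0 ≤ h * M * h := by
    have := sub_le_mul_sub_of_hasDerivAt_le (F := fun s => -Q s) (F' := fun s => -P s) (c := h * M)
      (a := -h) (b := 0) (fun s => (hQ s).neg) (by linarith) fun s hs => by
        have h1 := sub_le_mul_sub_of_hasDerivAt_le hP hs.2 fun t ht => hM t ⟨hs.1.trans ht.1, ht.2⟩
        have hM0 : 0 ≤ M := (hN0 _).trans (hM 0 ⟨by linarith, le_rfl⟩)
        have h2 := mul_le_mul_of_nonneg_left (show 0 - s ≤ h by linarith [hs.1]) hM0
        linarith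
    linarith
  have hPh : P h ≤ K * h := by
    have := hPsub 0 h le_rfl hh.le hT
    linarith
  rw [sub_add_cancel, add_zero] at hshift
  rw [show T - h - h = T - 2 * h by ring] at hwindow
  have k1 := mul_le_mul_of_nonneg_left hshift (mul_nonneg zero_le_four hκ)
  have k2 := mul_le_mul_of_nonneg_left (add_le_add hwindow hhist) (mul_nonneg zero_le_two hκ)
  have k3 := mul_nonneg (sub_nonneg.2 hσκ) (sub_nonneg.2 hPh)
  rw [hP0] at hmain
  linarith

end DelayEnergy

section Monomials

theorem monomial_le {a b c M δ P K Q e T : ℝ} (ha : 0 ≤ a) (hb : 0 ≤ b) (hc : 0 ≤ c)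
    (haM : a ≤ M) (hbM : b ≤ M) (hcM : c ≤ M) (hM : M ≤ δ) (hP : 0 ≤ P) (hK : 0 ≤ K)
    (hQ : 0 ≤ Q) (he : 0 ≤ e) (hT : 0 ≤ T) (hsum : P + K + Q = e + T) :
    a ^ P * b ^ K * c ^ Q ≤ δ ^ e * M ^ T := by
  have hM0 : 0 ≤ M := ha.trans haM
  calc a ^ P * b ^ K * c ^ Q ≤ M ^ P * M ^ K * M ^ Q := by
        gcongr
    _ = M ^ e * M ^ T := by
        rw [← Real.rpow_add_of_nonneg hM0 hP hK, ← Real.rpow_add_of_nonneg hM0 (by positivity) hQ,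
          hsum, Real.rpow_add_of_nonneg hM0 he hT]
    _ ≤ δ ^ e * M ^ T := by gcongr

theorem max_rpow_le_add {a b T : ℝ} (ha : 0 ≤ a) (hb : 0 ≤ b) : max a b ^ T ≤ a ^ T + b ^ T := by
  have := Real.rpow_nonneg ha T
  have := Real.rpow_nonneg hb T
  rcases max_choice a b with h | h <;> rw [h] <;> linarith

theorem mul_add_mul_add_le {a b c δ P K Q e T : ℝ} (ha : 0 ≤ a) (hb : 0 ≤ b) (hc : 0 ≤ c)
    (haδ : a ≤ δ) (hbδ : b ≤ δ) (hcδ : c ≤ δ) (hP : 0 ≤ P) (hK : 0 ≤ K)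
    (hQ : 0 ≤ Q) (he : 0 ≤ e) (hT : 0 ≤ T) (hsum : P + K + Q = e + T) :
    a ^ P * (a ^ K + b ^ K) * (a ^ Q + c ^ Q)
      ≤ δ ^ e * (4 * a ^ T + 2 * b ^ T + 2 * c ^ T) := by
  have h1 := monomial_le ha ha ha le_rfl le_rfl le_rfl haδ hP hK hQ he hT hsum
  have h2 := monomial_le ha ha hc (le_max_left a c) (le_max_left a c) (le_max_right a c)
    (max_le haδ hcδ) hP hK hQ he hT hsum
  have h3 := monomial_le ha hb ha (le_max_left a b) (le_max_right a b) (le_max_left a b)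
    (max_le haδ hbδ) hP hK hQ he hT hsum
  have h4 := monomial_le ha hb hc (le_max_left a (max b c))
    ((le_max_left b c).trans (le_max_right a _)) ((le_max_right b c).trans (le_max_right a _))
    (max_le haδ (max_le hbδ hcδ)) hP hK hQ he hT hsum
  have hδ : 0 ≤ δ ^ e := Real.rpow_nonneg (ha.trans haδ) e
  have m2 := mul_le_mul_of_nonneg_left (max_rpow_le_add (T := T) ha hc) hδ
  have m3 := mul_le_mul_of_nonneg_left (max_rpow_le_add (T := T) ha hb) hδ
  have m4 := mul_le_mul_of_nonneg_left ((max_rpow_le_add (T := T) ha (hb.trans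
    (le_max_left b c))).trans (add_le_add le_rfl (max_rpow_le_add (T := T) hb hc))) hδ
  linarith

theorem mul_add_le {a b c δ P Q e T : ℝ} (ha : 0 ≤ a) (hb : 0 ≤ b) (hc : 0 ≤ c)
    (haδ : a ≤ δ) (hcδ : c ≤ δ) (hP : 0 ≤ P)
    (hQ : 0 ≤ Q) (he : 0 ≤ e) (hT : 0 ≤ T) (hsum : P + Q = e + T) :
    a ^ P * (a ^ Q + c ^ Q) ≤ δ ^ e * (4 * a ^ T + 2 * b ^ T + 2 * c ^ T) := by
  have h1 := monomial_le ha ha ha le_rfl le_rfl le_rfl haδ hP le_rfl hQ he hT (by linarith)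
  have h2 := monomial_le ha ha hc (le_max_left a c) (le_max_left a c) (le_max_right a c)
    (max_le haδ hcδ) hP le_rfl hQ he hT (by linarith)
  rw [Real.rpow_zero, mul_one] at h1 h2
  have hδ : 0 ≤ δ ^ e := Real.rpow_nonneg (ha.trans haδ) e
  have m2 := mul_le_mul_of_nonneg_left (max_rpow_le_add (T := T) ha hc) hδ
  have := mul_nonneg hδ (Real.rpow_nonneg ha T)
  have := mul_nonneg hδ (Real.rpow_nonneg hb T)
  have := mul_nonneg hδ (Real.rpow_nonneg hc T)
  linarith

end Monomials

section HomogeneousNorm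

variable {n : ℕ} {r : Fin n → ℝ} {p : ℝ}

theorem hnorm_nonneg (x : Fin n → ℝ) : 0 ≤ hnorm n r p x :=
  Real.rpow_nonneg (Finset.sum_nonneg fun _ _ => Real.rpow_nonneg (abs_nonneg _) _) _

theorem continuous_hnorm (hr : ∀ i, 0 < r i) (hp : 0 < p) : Continuous (hnorm n r p) := by
  unfold hnorm
  refine Continuous.rpow_const (continuous_finsetSum _ fun i _ => ?_) fun _ => Or.inr (by positivity)
  exact (continuous_apply i).abs.rpow_const fun _ => Or.inr (div_pos hp (hr i)).le

theorem hnorm_one_pos (hn : 1 ≤ n) : 0 < hnorm n r p 1 := by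
  have : NeZero n := ⟨by omega⟩
  simp only [hnorm, Pi.one_apply, abs_one, Real.one_rpow, Finset.sum_const, Finset.card_univ,
    Fintype.card_fin, nsmul_eq_mul, mul_one]
  have : (0 : ℝ) < n := by exact_mod_cast hn
  positivity

end HomogeneousNorm

section Coordinates

variable {n : ℕ}

theorem clm_apply_eq_sum {F : Type*} [NormedAddCommGroup F] [NormedSpace ℝ F]
    (ℓ : (Fin n → ℝ) →L[ℝ] F) (v : Fin n → ℝ) : ℓ v = ∑ i, v i • ℓ (Pi.single i 1) := by
  conv_lhs => rw [pi_eq_sum_univ' v, map_sum]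
  simp only [map_smul]

theorem pd_eq_fderiv {f : (Fin n → ℝ) → (Fin n → ℝ) → (Fin n → ℝ)} {y : Fin n → ℝ}
    (hd : Differentiable ℝ fun z => f z y) (i j : Fin n) (x : Fin n → ℝ) :
    pd n f i j x y = fderiv ℝ (fun z => f z y) x (Pi.single j 1) i := by
  have h1 : HasFDerivAt (fun z => f z y) (fderiv ℝ (fun z => f z y) x)
      (Function.update x j (x j)) := by
    rw [Function.update_eq_self]; exact (hd x).hasFDerivAt
  exact (hasDerivAt_pi.1 (h1.comp_hasDerivAt (x j) (hasDerivAt_update x j (x j))) i).deriv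

theorem fderiv_apply_eq_sum_pd {f : (Fin n → ℝ) → (Fin n → ℝ) → (Fin n → ℝ)} {y : Fin n → ℝ}
    (hd : Differentiable ℝ fun z => f z y) (x u : Fin n → ℝ) (i : Fin n) :
    fderiv ℝ (fun z => f z y) x u i = ∑ j, u j * pd n f i j x y := by
  rw [clm_apply_eq_sum, Finset.sum_apply]
  exact Finset.sum_congr rfl fun j _ => by rw [pd_eq_fderiv hd]; rfl

theorem abs_fderiv_fderiv_le {V : (Fin n → ℝ) → ℝ} (hV : ContDiff ℝ 2 V) (z u v : Fin n → ℝ) :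
    |fderiv ℝ (fderiv ℝ V) z u v| ≤ ∑ i, ∑ j, |u j| * |v i| *
      |fderiv ℝ (fun z => fderiv ℝ V z (Pi.single i 1)) z (Pi.single j 1)| := by
  have hV1 : DifferentiableAt ℝ (fderiv ℝ V) z :=
    ((hV.fderiv_right (m := 1) (by norm_num)).differentiable (by norm_num)) z
  have e : ∀ i j, fderiv ℝ (fun z => fderiv ℝ V z (Pi.single i 1)) z (Pi.single j 1)
      = fderiv ℝ (fderiv ℝ V) z (Pi.single j 1) (Pi.single i 1) := fun i j => by
    rw [fderiv_clm_apply hV1 (differentiableAt_const _)]; simp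
  rw [clm_apply_eq_sum _ v]
  refine (Finset.abs_sum_le_sum_abs _ _).trans (Finset.sum_le_sum fun i _ => ?_)
  rw [clm_apply_eq_sum (fderiv ℝ (fderiv ℝ V) z) u]
  simp only [sum_apply, smul_apply, smul_eq_mul]
  rw [Finset.mul_sum]
  refine (Finset.abs_sum_le_sum_abs _ _).trans (Finset.sum_le_sum fun j _ => le_of_eq ?_)
  rw [e, abs_mul, abs_mul]; ring

end Coordinates

section Estimates

variable {n : ℕ} {r : Fin n → ℝ} {p μ γ : ℝ} {f : (Fin n → ℝ) → (Fin n → ℝ) → (Fin n → ℝ)}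
  {V : (Fin n → ℝ) → ℝ} {m β : Fin n → ℝ} {η ψ : Fin n → Fin n → ℝ}

/-- The pointwise bound on the derivative of `s ↦ ∇V(x(s)) f(x(s), y)` along a solution. -/
theorem abs_derivative_remainder_le (hr : ∀ i, 0 < r i) (hμ : 0 < μ)
    (hd : ∀ y, Differentiable ℝ fun z => f z y)
    (hm : ∀ i, 0 < m i)
    (hfm : ∀ x y : Fin n → ℝ, ∀ i,
      |f x y i| ≤ m i * (hnorm n r p x ^ (μ + r i) + hnorm n r p y ^ (μ + r i)))
    (hη : ∀ i j, 0 < η i j)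
    (hfd1 : ∀ i j, 0 ≤ μ + r i - r j → ∀ x y : Fin n → ℝ,
      |pd n f i j x y| ≤ η i j * (hnorm n r p x ^ (μ + r i - r j) + hnorm n r p y ^ (μ + r i - r j)))
    (hfd2 : ∀ i j, μ + r i - r j < 0 → ∀ x y : Fin n → ℝ, |pd n f i j x y| ≤ η i j)
    (hV : ContDiff ℝ 2 V) (hγ : ∀ i, 2 * r i ≤ γ) (hγ0 : 0 < γ) (hβ : ∀ i, 0 < β i)
    (hVd : ∀ x : Fin n → ℝ, ∀ i,
      |fderiv ℝ V x (Pi.single i 1)| ≤ β i * hnorm n r p x ^ (γ - r i))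
    (hψ : ∀ i j, 0 < ψ i j)
    (hVdd : ∀ x : Fin n → ℝ, ∀ i j,
      |fderiv ℝ (fun z => fderiv ℝ V z (Pi.single i 1)) x (Pi.single j 1)|
        ≤ ψ i j * hnorm n r p x ^ (γ - r i - r j))
    {δ : ℝ} (hδ : 0 < δ) {z y y' : Fin n → ℝ} (hz : hnorm n r p z ≤ δ) (hy : hnorm n r p y ≤ δ)
    (hy' : hnorm n r p y' ≤ δ) :
    |fderiv ℝ (fderiv ℝ V) z (f z y') (f z y)
        + fderiv ℝ V z (fderiv ℝ (fun z => f z y) z (f z y'))|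
      ≤ (∑ i, ∑ j, m j * (β i * η i j *
          (if 0 ≤ μ + r i - r j then 1 else δ ^ (r j - r i - μ)) + m i * ψ i j)) * δ ^ μ *
        (4 * hnorm n r p z ^ (γ + μ) + 2 * hnorm n r p y ^ (γ + μ)
          + 2 * hnorm n r p y' ^ (γ + μ)) := by
  set a := hnorm n r p z with ha_def
  set b := hnorm n r p y with hb_def
  set c := hnorm n r p y' with hc_def
  have ha : 0 ≤ a := hnorm_nonneg z
  have hb : 0 ≤ b := hnorm_nonneg y
  have hc : 0 ≤ c := hnorm_nonneg y'
  set B := 4 * a ^ (γ + μ) + 2 * b ^ (γ + μ) + 2 * c ^ (γ + μ) with hB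
  have hT : 0 ≤ γ + μ := by linarith
  have hu : ∀ j, |f z y' j| ≤ m j * (a ^ (μ + r j) + c ^ (μ + r j)) := fun j => hfm z y' j
  have hsecond : |fderiv ℝ (fderiv ℝ V) z (f z y') (f z y)|
      ≤ ∑ i, ∑ j, m j * (m i * ψ i j) * (δ ^ μ * B) := by
    refine (abs_fderiv_fderiv_le hV _ _ _).trans
      (Finset.sum_le_sum fun i _ => Finset.sum_le_sum fun j _ => ?_)
    have hmi := hm i
    have hmj := hm j
    have hψij := hψ i j
    calc _ ≤ (m j * (a ^ (μ + r j) + c ^ (μ + r j))) * (m i * (a ^ (μ + r i) + b ^ (μ + r i)))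
          * (ψ i j * a ^ (γ - r i - r j)) := by
          gcongr
          · exact hu j
          · exact hfm z y i
          · exact hVdd z i j
      _ = m j * (m i * ψ i j) * (a ^ (γ - r i - r j) * (a ^ (μ + r i) + b ^ (μ + r i))
          * (a ^ (μ + r j) + c ^ (μ + r j))) := by ring
      _ ≤ _ := by
          refine mul_le_mul_of_nonneg_left (mul_add_mul_add_le ha hb hc hz hy hy' ?_ ?_ ?_ hμ.le hT
            (by ring)) (by positivity)
          · linarith [hγ i, hγ j]
          · linarith [hr i]
          · linarith [hr j]
  have hfirst : |fderiv ℝ V z (fderiv ℝ (fun z => f z y) z (f z y'))|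
      ≤ ∑ i, ∑ j, m j * (β i * η i j *
          (if 0 ≤ μ + r i - r j then 1 else δ ^ (r j - r i - μ))) * (δ ^ μ * B) := by
    rw [clm_apply_eq_sum]
    refine (Finset.abs_sum_le_sum_abs _ _).trans (Finset.sum_le_sum fun i _ => ?_)
    rw [fderiv_apply_eq_sum_pd (hd y), smul_eq_mul, Finset.sum_mul]
    refine (Finset.abs_sum_le_sum_abs _ _).trans (Finset.sum_le_sum fun j _ => ?_)
    rw [abs_mul, abs_mul]
    have hmj := hm j
    have hβi := hβ i
    have hηij := hη i j
    split_ifs with hij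
    · calc _ ≤ (m j * (a ^ (μ + r j) + c ^ (μ + r j)))
            * (η i j * (a ^ (μ + r i - r j) + b ^ (μ + r i - r j))) * (β i * a ^ (γ - r i)) := by
            gcongr
            · exact hu j
            · exact hfd1 i j hij z y
            · exact hVd z i
        _ = m j * (β i * η i j * 1) * (a ^ (γ - r i) * (a ^ (μ + r i - r j) + b ^ (μ + r i - r j))
            * (a ^ (μ + r j) + c ^ (μ + r j))) := by ring
        _ ≤ _ := by
            refine mul_le_mul_of_nonneg_left (mul_add_mul_add_le ha hb hc hz hy hy' ?_ hij ?_ hμ.le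
              hT (by ring)) (by positivity)
            · linarith [hγ i, hr i]
            · linarith [hr j]
    · calc _ ≤ (m j * (a ^ (μ + r j) + c ^ (μ + r j))) * η i j * (β i * a ^ (γ - r i)) := by
            gcongr
            · exact hu j
            · exact hfd2 i j (not_le.1 hij) z y
            · exact hVd z i
        _ = m j * (β i * η i j) * (a ^ (γ - r i) * (a ^ (μ + r j) + c ^ (μ + r j))) := by ring
        _ ≤ m j * (β i * η i j) * (δ ^ (r j - r i) * B) := by
            refine mul_le_mul_of_nonneg_left (mul_add_le ha hb hc hz hy' ?_ ?_ ?_ hT (by ring))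
              (by positivity)
            · linarith [hγ i, hr i]
            · linarith [hr j]
            · linarith
        _ = _ := by
            have : δ ^ (r j - r i) = δ ^ (r j - r i - μ) * δ ^ μ := by
              rw [← Real.rpow_add hδ]; congr 1; ring
            rw [this]; ring
  refine (abs_add_le _ _).trans ((add_le_add hsecond hfirst).trans (le_of_eq ?_))
  rw [← Finset.sum_add_distrib, mul_assoc, Finset.sum_mul]
  refine Finset.sum_congr rfl fun i _ => ?_
  rw [← Finset.sum_add_distrib, Finset.sum_mul]
  exact Finset.sum_congr rfl fun j _ => by ring

theorem abs_fderiv_apply_le (hr : ∀ i, 0 < r i) (hμ : 0 < μ) (hm : ∀ i, 0 < m i)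
    (hfm : ∀ x y : Fin n → ℝ, ∀ i,
      |f x y i| ≤ m i * (hnorm n r p x ^ (μ + r i) + hnorm n r p y ^ (μ + r i)))
    (hγ : ∀ i, 2 * r i ≤ γ) (hβ : ∀ i, 0 < β i)
    (hVd : ∀ x : Fin n → ℝ, ∀ i,
      |fderiv ℝ V x (Pi.single i 1)| ≤ β i * hnorm n r p x ^ (γ - r i))
    {M : ℝ} {z y : Fin n → ℝ} (hz : hnorm n r p z ≤ M) (hy : hnorm n r p y ≤ M) :
    |fderiv ℝ V z (f z y)| ≤ (∑ i, β i * m i) * (hnorm n r p z ^ (γ + μ) + M ^ (γ + μ)) := by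
  have ha : 0 ≤ hnorm n r p z := hnorm_nonneg z
  have hb : 0 ≤ hnorm n r p y := hnorm_nonneg y
  have hM : 0 ≤ M := ha.trans hz
  rw [clm_apply_eq_sum, Finset.sum_mul]
  refine (Finset.abs_sum_le_sum_abs _ _).trans (Finset.sum_le_sum fun i _ => ?_)
  rw [smul_eq_mul, abs_mul]
  have hmi := hm i
  have hβi := hβ i
  have h1 : 0 ≤ γ - r i := by linarith [hγ i, hr i]
  have h2 : 0 ≤ μ + r i := by linarith [hr i]
  have h3 : γ + μ = γ - r i + (μ + r i) := by ring
  calc _ ≤ (m i * (hnorm n r p z ^ (μ + r i) + M ^ (μ + r i)))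
        * (β i * hnorm n r p z ^ (γ - r i)) := by
        gcongr
        · exact (hfm z y i).trans (by gcongr)
        · exact hVd z i
    _ = β i * m i * (hnorm n r p z ^ (γ - r i) * hnorm n r p z ^ (μ + r i)
          + hnorm n r p z ^ (γ - r i) * M ^ (μ + r i)) := by ring
    _ ≤ β i * m i * (hnorm n r p z ^ (γ - r i) * hnorm n r p z ^ (μ + r i)
          + M ^ (γ - r i) * M ^ (μ + r i)) := by gcongr
    _ = _ := by
        rw [h3, Real.rpow_add_of_nonneg ha h1 h2, Real.rpow_add_of_nonneg hM h1 h2]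

end Estimates

section Barbalat

/-- Barbalat's lemma for a nonnegative uniformly continuous function. -/
theorem tendsto_zero_of_integral_bounded {g : ℝ → ℝ} (hg : Continuous g) (hg0 : ∀ t, 0 ≤ g t)
    (huc : UniformContinuousOn g (Ici 0)) {C : ℝ}
    (hC : ∀ T, 0 ≤ T → ∫ s in (0 : ℝ)..T, g s ≤ C) : Tendsto g atTop (𝓝 0) := by
  have hi : ∀ a b, IntervalIntegrable g volume a b := fun a b => hg.intervalIntegrable a b
  have hsub : ∀ a b, ∫ s in a..b, g s = (∫ s in (0 : ℝ)..b, g s) - ∫ s in (0 : ℝ)..a, g s :=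
    fun a b => (intervalIntegral.integral_interval_sub_left (hi _ _) (hi _ _)).symm
  have hmono : Monotone fun T => ∫ s in (0 : ℝ)..T, g s := fun a b hab => by
    have := intervalIntegral.integral_nonneg (μ := volume) hab fun s _ => hg0 s
    rw [hsub] at this
    simpa using this
  have hbdd : BddAbove (range fun T => ∫ s in (0 : ℝ)..T, g s) := by
    refine ⟨C, ?_⟩
    rintro _ ⟨T, rfl⟩
    exact (hmono (le_max_left T 0)).trans (hC _ (le_max_right T 0))
  have hlim := tendsto_atTop_ciSup hmono hbdd
  rw [Metric.tendsto_atTop]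
  intro ε hε
  obtain ⟨d, hd, hd'⟩ := Metric.uniformContinuousOn_iff.1 huc (ε / 2) (half_pos hε)
  have hdiff : Tendsto (fun T => ∫ s in T..(T + d / 2), g s) atTop (𝓝 0) := by
    rw [show (fun T => ∫ s in T..(T + d / 2), g s) = _ from funext fun T => hsub T (T + d / 2)]
    simpa using (hlim.comp (tendsto_atTop_add_const_right _ (d / 2) tendsto_id)).sub hlim
  obtain ⟨T₀, hT₀⟩ := Metric.tendsto_atTop.1 hdiff (d / 2 * (ε / 2)) (by positivity)
  refine ⟨max T₀ 0, fun t ht => ?_⟩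
  have ht0 : 0 ≤ t := (le_max_right _ _).trans ht
  rw [Real.dist_eq, sub_zero, abs_of_nonneg (hg0 t)]
  by_contra! hgt
  have h1 := hT₀ t ((le_max_left _ _).trans ht)
  have h2 : ∫ _ in t..(t + d / 2), ε / 2 ≤ ∫ s in t..(t + d / 2), g s := by
    refine intervalIntegral.integral_mono_on (by linarith) intervalIntegrable_const (hi _ _)
      fun s hs => ?_
    have := hd' t ht0 s (ht0.trans hs.1) (by
      rw [Real.dist_eq, abs_sub_comm, abs_of_nonneg (by linarith [hs.1])]; linarith [hs.2])
    rw [Real.dist_eq] at this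
    linarith [(abs_lt.1 this).2]
  rw [intervalIntegral.integral_const, smul_eq_mul, add_sub_cancel_left] at h2
  rw [Real.dist_eq, sub_zero] at h1
  linarith [le_abs_self (∫ s in t..(t + d / 2), g s)]

end Barbalat

section SolutionBounds

variable {n : ℕ} {r : Fin n → ℝ} {p μ γ : ℝ} {f : (Fin n → ℝ) → (Fin n → ℝ) → (Fin n → ℝ)}
  {V : (Fin n → ℝ) → ℝ} {m β : Fin n → ℝ}

theorem exists_norm_le_of_hnorm_le (hr : ∀ i, 0 < r i) (hp : 0 < p) (δ : ℝ) :
    ∃ R : ℝ, ∀ z : Fin n → ℝ, hnorm n r p z ≤ δ → ‖z‖ ≤ R := by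
  refine ⟨∑ i, |δ| ^ r i, fun z hz => ?_⟩
  have hnn : ∀ i, 0 ≤ |δ| ^ r i := fun i => Real.rpow_nonneg (abs_nonneg _) _
  rw [pi_norm_le_iff_of_nonneg (Finset.sum_nonneg fun i _ => hnn i)]
  intro i
  have hi := hr i
  refine le_trans ?_ (Finset.single_le_sum (fun i _ => hnn i) (Finset.mem_univ i))
  have h1 : (|z i| ^ (p / r i)) ^ (1 / p) ≤ hnorm n r p z :=
    Real.rpow_le_rpow (Real.rpow_nonneg (abs_nonneg _) _)
      (Finset.single_le_sum (f := fun i => |z i| ^ (p / r i))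
        (fun i _ => Real.rpow_nonneg (abs_nonneg _) _) (Finset.mem_univ i)) (by positivity)
  rw [← Real.rpow_mul (abs_nonneg _), show p / r i * (1 / p) = (r i)⁻¹ by field_simp] at h1
  have h2 := Real.rpow_le_rpow (Real.rpow_nonneg (abs_nonneg _) _)
    (h1.trans (hz.trans (le_abs_self δ))) hi.le
  rwa [← Real.rpow_mul (abs_nonneg _), inv_mul_cancel₀ hi.ne', Real.rpow_one] at h2

/-- Along a solution that stays bounded, the weight `hnorm ^ (γ + μ)` is uniformly continuous. -/
theorem uniformContinuousOn_delay_solution (hr : ∀ i, 0 < r i) (hp : 0 < p) (hμ : 0 < μ)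
    (hm : ∀ i, 0 < m i)
    (hfm : ∀ x y : Fin n → ℝ, ∀ i,
      |f x y i| ≤ m i * (hnorm n r p x ^ (μ + r i) + hnorm n r p y ^ (μ + r i)))
    (hγμ : 0 ≤ γ + μ) {h δ : ℝ} {X : ℝ → Fin n → ℝ} (hX : Continuous X)
    (hX' : ∀ t, 0 ≤ t → HasDerivWithinAt X (f (X t) (X (t - h))) (Ici t) t) (hh : 0 ≤ h)
    (hδ : ∀ t, -h ≤ t → hnorm n r p (X t) ≤ δ) :
    UniformContinuousOn (fun t => hnorm n r p (X t) ^ (γ + μ)) (Ici 0) := by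
  obtain ⟨R, hR⟩ := exists_norm_le_of_hnorm_le hr hp δ (n := n)
  have hδ0 : 0 ≤ δ := (hnorm_nonneg _).trans (hδ 0 (by linarith))
  set C : ℝ := ∑ i, m i * (δ ^ (μ + r i) + δ ^ (μ + r i)) with hC
  have hterm : ∀ i, 0 ≤ m i * (δ ^ (μ + r i) + δ ^ (μ + r i)) := fun i => by
    have := hm i
    positivity
  have hC0 : 0 ≤ C := Finset.sum_nonneg fun i _ => hterm i
  have hfC : ∀ t, 0 ≤ t → ‖f (X t) (X (t - h))‖ ≤ C := fun t ht => by
    rw [pi_norm_le_iff_of_nonneg hC0]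
    intro i
    refine le_trans ?_ (Finset.single_le_sum (fun i _ => hterm i) (Finset.mem_univ i))
    refine (hfm _ _ i).trans (mul_le_mul_of_nonneg_left ?_ (hm i).le)
    have h0 : 0 ≤ μ + r i := by linarith [hr i]
    exact add_le_add (Real.rpow_le_rpow (hnorm_nonneg _) (hδ t (by linarith)) h0)
      (Real.rpow_le_rpow (hnorm_nonneg _) (hδ (t - h) (by linarith)) h0)
  have hle : ∀ a b, 0 ≤ a → a ≤ b → ‖X b - X a‖ ≤ C * (b - a) := fun a b ha hab =>
    norm_image_sub_le_of_norm_deriv_right_le_segment hX.continuousOn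
      (fun t ht => hX' t (ha.trans ht.1)) (fun t ht => hfC t (ha.trans ht.1)) b ⟨hab, le_rfl⟩
  have hlip : LipschitzOnWith (Real.toNNReal C) X (Ici 0) := by
    refine LipschitzOnWith.of_dist_le_mul fun a ha b hb => ?_
    rw [Real.coe_toNNReal C hC0, dist_eq_norm, Real.dist_eq]
    rcases le_total a b with hab | hab
    · rw [norm_sub_rev, abs_sub_comm, abs_of_nonneg (sub_nonneg.2 hab)]
      exact hle a b ha hab
    · rw [abs_of_nonneg (sub_nonneg.2 hab)]
      exact hle b a hb hab
  have hN : UniformContinuousOn (fun z => hnorm n r p z ^ (γ + μ)) (Metric.closedBall 0 R) :=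
    (isCompact_closedBall _ _).uniformContinuousOn_of_continuous
      ((continuous_hnorm hr hp).rpow_const fun _ => Or.inr hγμ).continuousOn
  exact hN.comp hlip.uniformContinuousOn fun t ht =>
    mem_closedBall_zero_iff.2 (hR _ (hδ t (by linarith [mem_Ici.1 ht])))

end SolutionBounds

theorem stmt9
    (n : ℕ) (hn : 1 ≤ n) (r : Fin n → ℝ) (hr : ∀ i, 0 < r i) (p : ℝ) (hp : 1 ≤ p)
    (h μ : ℝ) (hh : 0 < h) (hμ : 0 < μ)
    (f : (Fin n → ℝ) → (Fin n → ℝ) → (Fin n → ℝ))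
    (hf_cd : ∀ y : Fin n → ℝ, ContDiff ℝ 1 fun x => f x y)
    (hf_lip : ∀ x : Fin n → ℝ, LocallyLipschitz fun y => f x y)
    (hf_hom : ∀ ε : ℝ, 0 < ε → ∀ x y : Fin n → ℝ, ∀ i,
      f (fun k => ε ^ r k * x k) (fun k => ε ^ r k * y k) i = ε ^ (μ + r i) * f x y i)
    (m : Fin n → ℝ) (hm : ∀ i, 0 < m i)
    (hfm : ∀ x y : Fin n → ℝ, ∀ i,
      |f x y i| ≤ m i * (hnorm n r p x ^ (μ + r i) + hnorm n r p y ^ (μ + r i)))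
    (η : Fin n → Fin n → ℝ) (hη : ∀ i j, 0 < η i j)
    (hfd1 : ∀ i j, 0 ≤ μ + r i - r j → ∀ x y : Fin n → ℝ,
      |pd n f i j x y| ≤ η i j * (hnorm n r p x ^ (μ + r i - r j) + hnorm n r p y ^ (μ + r i - r j)))
    (hfd2 : ∀ i j, μ + r i - r j < 0 → ∀ x y : Fin n → ℝ, |pd n f i j x y| ≤ η i j)
    (V : (Fin n → ℝ) → ℝ) (hV : ContDiff ℝ 2 V)
    (α0 α1 γ : ℝ) (hα0 : 0 < α0) (hα1 : 0 < α1) (hγ : ∀ i, 2 * r i ≤ γ)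
    (hVlb : ∀ x : Fin n → ℝ, α0 * hnorm n r p x ^ γ ≤ V x)
    (hVub : ∀ x : Fin n → ℝ, V x ≤ α1 * hnorm n r p x ^ γ)
    (β : Fin n → ℝ) (hβ : ∀ i, 0 < β i)
    (hVd : ∀ x : Fin n → ℝ, ∀ i,
      |fderiv ℝ V x (Pi.single i 1)| ≤ β i * hnorm n r p x ^ (γ - r i))
    (ψ : Fin n → Fin n → ℝ) (hψ : ∀ i j, 0 < ψ i j)
    (hVdd : ∀ x : Fin n → ℝ, ∀ i j,
      |fderiv ℝ (fun z => fderiv ℝ V z (Pi.single i 1)) x (Pi.single j 1)|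
        ≤ ψ i j * hnorm n r p x ^ (γ - r i - r j))
    (w : ℝ) (hw : 0 < w)
    (hVf : ∀ x : Fin n → ℝ, fderiv ℝ V x (f x x) ≤ -w * hnorm n r p x ^ (γ + μ))
    (w1 w2 : ℝ) (hw1 : 0 < w1) (hw2 : 0 < w2) (hw0 : 0 < w - w1 - h * w2)
    (α : ℝ) (hα : 1 < α)
    (H3 : ℝ) (hH3def : H3 = (α0 / (h * ∑ i, (1 + α ^ (μ + r i)) * m i * β i)) ^ (1 / μ))
    (δ : ℝ) (hδ0 : 0 < δ) (hδH3 : δ < H3)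
    (L : ℝ) (hLdef : L = ∑ i, ∑ j, m j * (β i * η i j *
      (if 0 ≤ μ + r i - r j then 1 else δ ^ (r j - r i - μ)) + m i * ψ i j))
    (H2 : ℝ) (hH2def : H2 = (min ((w - w1 - h * w2) / (4 * h * L))
      (min (w1 / (2 * h * L)) (w2 / (2 * L)))) ^ (1 / μ))
    (hδH2 : δ < H2)
    (a1t : ℝ) (ha1tdef : a1t = α0 - h * (∑ i, (1 + α ^ (μ + r i)) * m i * β i) * δ ^ μ)
    (b3 : ℝ) (hb3def : b3 = (w1 + h * w2 + 2 * h * ∑ i, β i * m i) * h)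
    (Δα : ℝ) (hΔα : 0 < Δα) (hroot : α1 * Δα ^ γ + b3 * Δα ^ (γ + μ) = a1t * δ ^ γ) :
    ∀ x : ℝ → Fin n → ℝ, IsSol n h f x → segNorm n r p h x 0 < Δα →
      Filter.Tendsto (fun t => hnorm n r p (x t)) Filter.atTop (nhds 0) := by
  intro x hx hseg
  have hp0 : 0 < p := by linarith
  have hne : NeZero n := ⟨by omega⟩
  have hγ0 : 0 < γ := by linarith [hγ 0, hr 0]
  have hγμ : 0 < γ + μ := by linarith
  have hd : ∀ y, Differentiable ℝ fun z => f z y := fun y => (hf_cd y).differentiable (by norm_num)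
  have hnc : Continuous (hnorm n r p) := continuous_hnorm hr hp0
  have hNc : Continuous fun z => hnorm n r p z ^ (γ + μ) :=
    hnc.rpow_const fun _ => Or.inr hγμ.le
  have hN0 : ∀ z, 0 ≤ hnorm n r p z ^ (γ + μ) := fun z => Real.rpow_nonneg (hnorm_nonneg z) _
  have hLpos : 0 < L := by
    rw [hLdef]
    refine Finset.sum_pos (fun i _ => Finset.sum_pos (fun j _ => ?_) Finset.univ_nonempty)
      Finset.univ_nonempty
    have := hm i; have := hm j; have := hβ i; have := hη i j; have := hψ i j
    split_ifs <;> positivity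
  have hδμ : δ ^ μ < min ((w - w1 - h * w2) / (4 * h * L))
      (min (w1 / (2 * h * L)) (w2 / (2 * L))) := by
    have h0 : 0 ≤ min ((w - w1 - h * w2) / (4 * h * L))
      (min (w1 / (2 * h * L)) (w2 / (2 * L))) := by positivity
    have := Real.rpow_lt_rpow hδ0.le hδH2 hμ
    rwa [hH2def, ← Real.rpow_mul h0, one_div_mul_cancel hμ.ne', Real.rpow_one] at this
  obtain ⟨hκ₀, hκ₁, hκ₂⟩ : δ ^ μ < (w - w1 - h * w2) / (4 * h * L) ∧
      δ ^ μ < w1 / (2 * h * L) ∧ δ ^ μ < w2 / (2 * L) := by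
    simpa only [lt_min_iff] using hδμ
  rw [lt_div_iff₀ (by positivity)] at hκ₀ hκ₁ hκ₂
  have hhκ₂ := mul_lt_mul_of_pos_left hκ₂ hh
  set X : ℝ → Fin n → ℝ := fun t => x (max t (-h)) with hXdef
  have hXx : ∀ t, -h ≤ t → X t = x t := fun t ht => by simp only [hXdef, max_eq_left ht]
  have hX : Continuous X := hx.1.comp_continuous (by fun_prop) fun t => mem_Ici.2 (le_max_right _ _)
  have hX' : ∀ t, 0 ≤ t → HasDerivWithinAt X (f (X t) (X (t - h))) (Ici t) t := fun t ht => by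
    rw [hXx t (by linarith), hXx (t - h) (by linarith)]
    refine ((hx.2 t ht).mono (Ici_subset_Ici.2 ht)).congr (fun s hs => ?_) (hXx t (by linarith))
    exact hXx s (by linarith [mem_Ici.1 hs])
  set N : (Fin n → ℝ) → ℝ := fun z => hnorm n r p z ^ (γ + μ) with hNdef
  set K := δ ^ (γ + μ) with hKdef
  set M := segNorm n r p h x 0 ^ (γ + μ) with hMdef
  set σ := ∑ i, β i * m i with hσdef
  set P : ℝ → ℝ := fun t => ∫ s in (0 : ℝ)..t, N (X s) with hPdef
  have hNX : Continuous fun t => N (X t) := hNc.comp hX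
  have hP : ∀ t, HasDerivAt P (N (X t)) t := fun t =>
    intervalIntegral.integral_hasDerivAt_right (hNX.intervalIntegrable _ _)
      (hNX.stronglyMeasurableAtFilter _ _) hNX.continuousAt
  have hP0 : P 0 = 0 := intervalIntegral.integral_same
  have hα01 : α0 ≤ α1 := by
    have h1 := (hVlb 1).trans (hVub 1)
    exact le_of_mul_le_mul_right h1 (Real.rpow_pos_of_pos (hnorm_one_pos hn) γ)
  have hσ0 : 0 ≤ σ := Finset.sum_nonneg fun i _ => (mul_pos (hβ i) (hm i)).le
  have hsum : 2 * σ ≤ ∑ i, (1 + α ^ (μ + r i)) * m i * β i := by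
    rw [hσdef, Finset.mul_sum]
    refine Finset.sum_le_sum fun i _ => ?_
    have h1 := Real.one_le_rpow hα.le (show 0 ≤ μ + r i by linarith [hr i])
    have := mul_le_mul_of_nonneg_right h1 (mul_pos (hm i) (hβ i)).le
    linarith
  have hwσ : w ≤ 2 * σ := by
    have h1 := neg_le_of_abs_le (abs_fderiv_apply_le (z := 1) (y := 1) hr hμ hm hfm hγ hβ hVd
      le_rfl le_rfl)
    refine le_of_mul_le_mul_right ?_ (Real.rpow_pos_of_pos (hnorm_one_pos (r := r) (p := p) hn)
      (γ + μ))
    linarith [hVf 1]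
  have hσκ : 4 * h * (L * δ ^ μ) ≤ σ := by linarith
  have hb3 : 4 * h ^ 2 * (L * δ ^ μ) ≤ b3 := by
    rw [hb3def]
    have h1 : 0 ≤ 2 * h * σ := by positivity
    have h2 : 4 * h * (L * δ ^ μ) ≤ w1 + h * w2 + 2 * h * σ := by linarith
    linarith [mul_le_mul_of_nonneg_right h2 hh.le]
  have hδμ0 : 0 < δ ^ μ := Real.rpow_pos_of_pos hδ0 μ
  have ha1t : a1t ≤ α0 - 2 * h * σ * δ ^ μ := by
    rw [ha1tdef]
    have := mul_le_mul_of_nonneg_right (mul_le_mul_of_nonneg_left hsum hh.le) hδμ0.le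
    linarith
  have hΔδ : Δα ≤ δ := by
    by_contra! hlt
    have h1 : a1t * δ ^ γ ≤ α1 * δ ^ γ := by
      refine mul_le_mul_of_nonneg_right ?_ (by positivity)
      have : 0 ≤ 2 * h * σ * δ ^ μ := by positivity
      linarith
    have h2 := mul_lt_mul_of_pos_left (Real.rpow_lt_rpow hδ0.le hlt hγ0) hα1
    have h3 : 0 ≤ b3 * Δα ^ (γ + μ) := mul_nonneg (hb3.trans' (by positivity)) (by positivity)
    linarith
  have hinit : ∀ s ∈ Icc (-h) 0, hnorm n r p (X s) ≤ segNorm n r p h x 0 := fun s hs => by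
    rw [hXx s hs.1]
    have hcomp : ContinuousOn (fun θ => hnorm n r p (x (0 + θ))) (Icc (-h) 0) := by
      simp only [zero_add]
      exact hnc.comp_continuousOn (hx.1.mono Icc_subset_Ici_self)
    exact le_csSup (isCompact_Icc.image_of_continuousOn hcomp).bddAbove ⟨s, hs, by simp⟩
  have hM0 : 0 ≤ segNorm n r p h x 0 := (hnorm_nonneg _).trans (hinit 0 ⟨by linarith, le_rfl⟩)
  have hM : ∀ t ∈ Icc (-h) 0, N (X t) ≤ M := fun t ht =>
    Real.rpow_le_rpow (hnorm_nonneg _) (hinit t ht) hγμ.le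
  have hinit0 : V (X 0) + 2 * σ * h * K + 2 * (L * δ ^ μ) * h ^ 2 * M < α0 * δ ^ γ := by
    have h1 := hVub (X 0)
    have h2 : hnorm n r p (X 0) ^ γ ≤ segNorm n r p h x 0 ^ γ :=
      Real.rpow_le_rpow (hnorm_nonneg _) (hinit 0 ⟨by linarith, le_rfl⟩) hγ0.le
    have h3 := mul_lt_mul_of_pos_left (Real.rpow_lt_rpow hM0 hseg hγ0) hα1
    have h4 := mul_le_mul_of_nonneg_left h2 hα1.le
    have h5 : M ≤ Δα ^ (γ + μ) := Real.rpow_le_rpow hM0 hseg.le hγμ.le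
    have h6 : 2 * (L * δ ^ μ) * h ^ 2 * M ≤ b3 * Δα ^ (γ + μ) :=
      mul_le_mul (hb3.trans' (by
        have : 0 ≤ h ^ 2 * (L * δ ^ μ) := by positivity
        linarith)) h5 (Real.rpow_nonneg hM0 _) (hb3.trans' (by positivity))
    have h7 := mul_le_mul_of_nonneg_right ha1t (Real.rpow_nonneg hδ0.le γ)
    have h8 : K = δ ^ μ * δ ^ γ := by rw [hKdef, add_comm, Real.rpow_add hδ0]
    rw [h8]
    linarith
  have hVσ : ∀ T, (∀ t ∈ Icc (-h) T, hnorm n r p (X t) ≤ δ) →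
      ∀ t ∈ Icc 0 T, fderiv ℝ V (X t) (f (X t) (X (t - h))) ≤ σ * (N (X t) + K) :=
    fun T hle t ht => (le_abs_self _).trans (abs_fderiv_apply_le hr hμ hm hfm hγ hβ hVd
      (hle t ⟨by linarith [ht.1], ht.2⟩) (hle (t - h) ⟨by linarith [ht.1], by linarith [ht.2]⟩))
  have hNK : ∀ T, (∀ t ∈ Icc (-h) T, hnorm n r p (X t) ≤ δ) → ∀ t ∈ Icc 0 T, N (X t) ≤ K :=
    fun T hle t ht => Real.rpow_le_rpow (hnorm_nonneg _) (hle t ⟨by linarith [ht.1], ht.2⟩) hγμ.le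
  have henergy : ∀ T, h ≤ T → (∀ t ∈ Icc (-h) T, hnorm n r p (X t) ≤ δ) →
      V (X T) + (w - 8 * h * (L * δ ^ μ)) * P (T - h)
        ≤ V (X 0) + 2 * σ * h * K + 2 * (L * δ ^ μ) * h ^ 2 * M :=
    fun T hT hle => lyapunov_add_integral_le (κ := L * δ ^ μ) (S := {z | hnorm n r p z ≤ δ}) hh
      (by positivity) hσκ hd hV hN0 hVf
      (fun z hz y hy y' hy' => by
        rw [hLdef]
        exact abs_derivative_remainder_le hr hμ hd hm hfm hη hfd1 hfd2 hV hγ hγ0 hβ hVd hψ hVdd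
          hδ0 hz hy hy') hX hX' hP hP0 hT (hVσ T hle) hle (hNK T hle) hM
  have hc₀ : 0 < w - 8 * h * (L * δ ^ μ) := by linarith
  have hPnn : ∀ t, 0 ≤ t → 0 ≤ P t := fun t ht =>
    intervalIntegral.integral_nonneg ht fun s _ => hN0 _
  have hstay : ∀ t, -h ≤ t → hnorm n r p (X t) < δ := by
    by_contra! hex
    obtain ⟨t₂, ht₂, hδt₂⟩ := hex
    have hclosed : IsClosed {t | hnorm n r p (X t) = δ} := isClosed_eq (hnc.comp hX) continuous_const
    have hlt0 : ∀ s ∈ Icc (-h) 0, hnorm n r p (X s) < δ := fun s hs =>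
      ((hinit s hs).trans_lt hseg).trans_le hΔδ
    have ht₂0 : 0 ≤ t₂ := by
      by_contra! hneg
      exact absurd (hlt0 t₂ ⟨ht₂, hneg.le⟩) (not_lt.2 hδt₂)
    have hivt : ∀ t, 0 ≤ t → δ ≤ hnorm n r p (X t) →
        ∃ s ∈ Icc 0 t, hnorm n r p (X s) = δ := fun t ht hle =>
      intermediate_value_Icc ht (hnc.comp hX).continuousOn
        ⟨(hlt0 0 ⟨by linarith, le_rfl⟩).le, hle⟩
    obtain ⟨s₀, hs₀, hs₀δ⟩ := hivt t₂ ht₂0 hδt₂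
    obtain ⟨t₁, ⟨⟨ht₁0, ht₁s⟩, ht₁δ⟩, hleast⟩ :=
      ((isCompact_Icc (a := (0 : ℝ)) (b := s₀)).inter_right hclosed).exists_isLeast
        ⟨s₀, ⟨hs₀.1, le_rfl⟩, hs₀δ⟩
    have hle : ∀ t ∈ Icc (-h) t₁, hnorm n r p (X t) ≤ δ := fun t ht => by
      by_contra! hgt
      have ht0 : 0 ≤ t := by
        by_contra! hneg
        exact absurd (hlt0 t ⟨ht.1, hneg.le⟩) (not_lt.2 hgt.le)
      obtain ⟨s, hs, hsδ⟩ := hivt t ht0 hgt.le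
      have h1 : t₁ ≤ s := hleast ⟨⟨hs.1, (hs.2.trans ht.2).trans ht₁s⟩, hsδ⟩
      have h2 : t = t₁ := le_antisymm ht.2 (h1.trans hs.2)
      rw [h2] at hgt
      exact hgt.ne' ht₁δ
    have h1 := hVlb (X t₁)
    rw [show hnorm n r p (X t₁) = δ from ht₁δ] at h1
    rcases le_total h t₁ with hht | hht
    · have h2 := henergy t₁ hht hle
      have h3 := mul_nonneg hc₀.le (hPnn (t₁ - h) (by linarith))
      linarith
    · have h2 := lyapunov_le_of_derivative_bound hV hX hX' hP hP0 (hVσ t₁ hle) ht₁0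
      have h3 := sub_le_mul_sub_of_hasDerivAt_le hP ht₁0 (hNK t₁ hle)
      have hK0 : 0 ≤ K := Real.rpow_nonneg hδ0.le _
      have h4 : P t₁ + t₁ * K ≤ 2 * h * K := by linarith [mul_le_mul_of_nonneg_right hht hK0]
      have h5 := mul_le_mul_of_nonneg_left h4 hσ0
      have h6 : 0 ≤ 2 * (L * δ ^ μ) * h ^ 2 * M :=
        mul_nonneg (by positivity) (Real.rpow_nonneg hM0 _)
      linarith
  have hintegral : ∀ T, 0 ≤ T → P T ≤ α0 * δ ^ γ / (w - 8 * h * (L * δ ^ μ)) := fun T hT => by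
    rw [le_div_iff₀ hc₀]
    have h1 := henergy (T + h) (by linarith) fun t ht => (hstay t ht.1).le
    rw [add_sub_cancel_right] at h1
    have h2 : 0 ≤ α0 * hnorm n r p (X (T + h)) ^ γ :=
      mul_nonneg hα0.le (Real.rpow_nonneg (hnorm_nonneg _) _)
    linarith [hVlb (X (T + h))]
  have huc : UniformContinuousOn (fun t => N (X t)) (Ici 0) :=
    uniformContinuousOn_delay_solution hr hp0 hμ hm hfm hγμ.le hX hX' hh.le fun t ht => (hstay t ht).le
  have hlim := tendsto_zero_of_integral_bounded (hNc.comp hX) (fun t => hN0 _) huc hintegral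
  have hlim' := hlim.rpow_const (p := 1 / (γ + μ)) (Or.inr (by positivity))
  rw [Real.zero_rpow (by positivity)] at hlim'
  refine hlim'.congr' ?_
  filter_upwards [eventually_ge_atTop 0] with t ht
  simp only [Function.comp, hNdef]
  rw [← Real.rpow_mul (hnorm_nonneg _), mul_one_div_cancel hγμ.ne', Real.rpow_one,
    hXx t (by linarith)]
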